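/- arXiv:2212.08422 — 2 statements merged into one kernel-verified Lean document; each statement's English description precedes it below -/
import Mathlib

section
/- Let δ ≥ 1 and m ≥ δ+2 be integers. The lower triangulation of C(m, δ) is a triangulation of C(m, δ), and the upper triangulation of C(m, δ) is a triangulation of C(m, δ). -/
open Finset

noncomputable section

/-- The moment curve `p_δ(t) = (t, t², …, t^δ)` in `ℝ^δ`. -/
def momCurve (δ : ℕ) (t : ℝ) : Fin δ → ℝ := fun i => t ^ (i.1 + 1)

/-- The points `p_δ(a)` on the moment curve for `a` ranging over a finite set of naturals. -/
def momPts (δ : ℕ) (A : Finset ℕ) : Set (Fin δ → ℝ) :=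
  (fun a : ℕ => momCurve δ (a : ℝ)) '' (A : Set ℕ)

/-- The simplex `|A|_δ`, i.e. the convex hull of the points `p_δ(a)`, `a ∈ A`. -/
def smp (δ : ℕ) (A : Finset ℕ) : Set (Fin δ → ℝ) := convexHull ℝ (momPts δ A)

/-- The cyclic polytope `C(m, δ) = conv{p_δ(1), …, p_δ(m)}`. -/
def cyc (m δ : ℕ) : Set (Fin δ → ℝ) := smp δ (Finset.Icc 1 m)

/-- The last standard basis vector `e_δ` of `ℝ^δ`. -/
def eLast (δ : ℕ) : Fin δ → ℝ := fun i => if i.1 = δ - 1 then 1 else 0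

/-- The last coordinate of a point of `ℝ^δ`. -/
def lastCoord {δ : ℕ} (x : Fin δ → ℝ) : ℝ :=
  if h : 0 < δ then x ⟨δ - 1, Nat.sub_lt h one_pos⟩ else 0

/-- `x` lies strictly above `V`: `x - r • e_δ ∈ V` for some `r > 0`. -/
def StrictlyAbove {δ : ℕ} (x : Fin δ → ℝ) (V : Set (Fin δ → ℝ)) : Prop :=
  ∃ r : ℝ, 0 < r ∧ x - r • eLast δ ∈ V

/-- `x` lies strictly below `V`: `x - r • e_δ ∈ V` for some `r < 0`. -/
def StrictlyBelow {δ : ℕ} (x : Fin δ → ℝ) (V : Set (Fin δ → ℝ)) : Prop :=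
  ∃ r : ℝ, r < 0 ∧ x - r • eLast δ ∈ V

/-- `|F|_δ` is a lower facet of the cyclic polytope `C(m, δ)`. -/
def IsLowerFacet (m δ : ℕ) (F : Finset ℕ) : Prop :=
  F ⊆ Finset.Icc 1 m ∧ F.card = δ ∧
    ∀ i ∈ Finset.Icc 1 m, i ∉ F →
      StrictlyAbove (momCurve δ (i : ℝ))
        ((affineSpan ℝ (momPts δ F) : AffineSubspace ℝ (Fin δ → ℝ)) : Set (Fin δ → ℝ))

/-- `|F|_δ` is an upper facet of the cyclic polytope `C(m, δ)`. -/
def IsUpperFacet (m δ : ℕ) (F : Finset ℕ) : Prop :=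
  F ⊆ Finset.Icc 1 m ∧ F.card = δ ∧
    ∀ i ∈ Finset.Icc 1 m, i ∉ F →
      StrictlyBelow (momCurve δ (i : ℝ))
        ((affineSpan ℝ (momPts δ F) : AffineSubspace ℝ (Fin δ → ℝ)) : Set (Fin δ → ℝ))

/-- The facet `|H ∖ {c}|_δ` of the simplex `|H|_δ` is a lower facet of `|H|_δ`. -/
def IsLowerFacetOfSimplex (δ : ℕ) (H : Finset ℕ) (c : ℕ) : Prop :=
  c ∈ H ∧ StrictlyAbove (momCurve δ (c : ℝ))
    ((affineSpan ℝ (momPts δ (H.erase c)) : AffineSubspace ℝ (Fin δ → ℝ)) : Set (Fin δ → ℝ))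

/-- The facet `|H ∖ {c}|_δ` of the simplex `|H|_δ` is an upper facet of `|H|_δ`. -/
def IsUpperFacetOfSimplex (δ : ℕ) (H : Finset ℕ) (c : ℕ) : Prop :=
  c ∈ H ∧ StrictlyBelow (momCurve δ (c : ℝ))
    ((affineSpan ℝ (momPts δ (H.erase c)) : AffineSubspace ℝ (Fin δ → ℝ)) : Set (Fin δ → ℝ))

/-- `T` is a triangulation of the cyclic polytope `C(m, δ)`. -/
def IsTriangulation (m δ : ℕ) (T : Finset (Finset ℕ)) : Prop :=
  (∀ S ∈ T, S ⊆ Finset.Icc 1 m ∧ S.card = δ + 1) ∧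
  (⋃ S ∈ T, smp δ S) = cyc m δ ∧
  ∀ S ∈ T, ∀ S' ∈ T, smp δ S ∩ smp δ S' = smp δ (S ∩ S')

/-- `A` is a face of the triangulation `T`. -/
def IsFace (T : Finset (Finset ℕ)) (A : Finset ℕ) : Prop := ∃ S ∈ T, A ⊆ S

/-- `A ≀ B`: writing `A = {a_0 < … < a_d}` and `B = {b_0 < … < b_d}`, we have
`a_0 < b_0 < a_1 < b_1 < … < a_d < b_d`. -/
def Intertwines (d : ℕ) (A B : Finset ℕ) : Prop :=
  ∃ a b : Fin (d + 1) → ℕ, StrictMono a ∧ StrictMono b ∧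
    A = Finset.image a Finset.univ ∧ B = Finset.image b Finset.univ ∧
    (∀ i, a i < b i) ∧ ∀ i : Fin d, b i.castSucc < a i.succ

/-- `y = ℓ_S(x)` is the lift of `x ∈ |S|_δ` to `ℝ^{δ+1}` given by the barycentric
coordinates of `x` with respect to the vertices of `|S|_δ`. -/
def IsLift (δ : ℕ) (S : Finset ℕ) (x : Fin δ → ℝ) (y : Fin (δ + 1) → ℝ) : Prop :=
  ∃ w : ℕ → ℝ, (∀ a ∈ S, 0 ≤ w a) ∧ (∑ a ∈ S, w a) = 1 ∧
    (∑ a ∈ S, w a • momCurve δ (a : ℝ)) = x ∧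
    (∑ a ∈ S, w a • momCurve (δ + 1) (a : ℝ)) = y

/-- `|A|_δ` is submerged by the triangulation `T`. -/
def Submerged (δ : ℕ) (T : Finset (Finset ℕ)) (A : Finset ℕ) : Prop :=
  ∀ S ∈ T, ∀ x ∈ smp δ A ∩ smp δ S, ∀ y y' : Fin (δ + 1) → ℝ,
    IsLift δ A x y → IsLift δ S x y' → lastCoord y ≤ lastCoord y'

/-- `|A|_δ` is supermerged by the triangulation `T`. -/
def Supermerged (δ : ℕ) (T : Finset (Finset ℕ)) (A : Finset ℕ) : Prop :=
  ∀ S ∈ T, ∀ x ∈ smp δ A ∩ smp δ S, ∀ y y' : Fin (δ + 1) → ℝ,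
    IsLift δ A x y → IsLift δ S x y' → lastCoord y' ≤ lastCoord y

/-- The second higher Stasheff–Tamari order `T ≤₂ T'`. -/
def HST2 (δ : ℕ) (T T' : Finset (Finset ℕ)) : Prop :=
  ∀ S ∈ T, ∀ S' ∈ T', ∀ x ∈ smp δ S ∩ smp δ S', ∀ y y' : Fin (δ + 1) → ℝ,
    IsLift δ S x y → IsLift δ S' x y' → lastCoord y ≤ lastCoord y'

open scoped Classical in
/-- The lower triangulation of `C(m, δ)`: the collection of `(δ+1)`-element subsets `F` of
`{1, …, m}` such that `|F|_{δ+1}` is a lower facet of `C(m, δ+1)`. -/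
def lowerTriang (m δ : ℕ) : Finset (Finset ℕ) :=
  (Finset.Icc 1 m).powerset.filter (fun F => IsLowerFacet m (δ + 1) F)

open scoped Classical in
/-- The upper triangulation of `C(m, δ)`. -/
def upperTriang (m δ : ℕ) : Finset (Finset ℕ) :=
  (Finset.Icc 1 m).powerset.filter (fun F => IsUpperFacet m (δ + 1) F)

open scoped Classical in
/-- `L(H)`: the `(δ+1)`-element subsets `G` of `H` with `|G|_{δ+1}` a lower facet of the
simplex `|H|_{δ+1}`. -/
def LH (δ : ℕ) (H : Finset ℕ) : Finset (Finset ℕ) :=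
  (H.filter (fun c => IsLowerFacetOfSimplex (δ + 1) H c)).image (fun c => H.erase c)

open scoped Classical in
/-- `U(H)`: the `(δ+1)`-element subsets `G` of `H` with `|G|_{δ+1}` an upper facet of the
simplex `|H|_{δ+1}`. -/
def UH (δ : ℕ) (H : Finset ℕ) : Finset (Finset ℕ) :=
  (H.filter (fun c => IsUpperFacetOfSimplex (δ + 1) H c)).image (fun c => H.erase c)

open Polynomial in
/-- The polynomial `∏_{a ∈ A} (X - a)`. -/
def nodePoly (A : Finset ℕ) : ℝ[X] := Lagrange.nodal A (fun a : ℕ => (a : ℝ))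

section NodePoly

open Polynomial

lemma nodePoly_monic (A : Finset ℕ) : (nodePoly A).Monic := Lagrange.nodal_monic

lemma natDegree_nodePoly (A : Finset ℕ) : (nodePoly A).natDegree = A.card :=
  Lagrange.natDegree_nodal

lemma eval_nodePoly (A : Finset ℕ) (t : ℝ) : (nodePoly A).eval t = ∏ a ∈ A, (t - (a : ℝ)) :=
  Lagrange.eval_nodal

lemma eval_nodePoly_eq_zero_iff (A : Finset ℕ) (i : ℕ) :
    (nodePoly A).eval (i : ℝ) = 0 ↔ i ∈ A := by
  simp [eval_nodePoly, Finset.prod_eq_zero_iff, sub_eq_zero]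

lemma eval_nodePoly_insert {A : Finset ℕ} {c : ℕ} (hc : c ∉ A) (t : ℝ) :
    (nodePoly (insert c A)).eval t = (t - c) * (nodePoly A).eval t := by
  simp [eval_nodePoly, Finset.prod_insert hc]

lemma eval_eq_sum_eval_nodePoly_erase {S : Finset ℕ} {f : ℝ[X]} (hf : f.degree < S.card)
    (t : ℝ) :
    f.eval t = ∑ c ∈ S, ((nodePoly (S.erase c)).eval t / (nodePoly (S.erase c)).eval (c : ℝ)) *
      f.eval (c : ℝ) := by
  have hinj : Set.InjOn (fun a : ℕ => (a : ℝ)) S := Nat.cast_injective.injOn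
  conv_lhs => rw [Lagrange.eq_interpolate hinj hf, Lagrange.interpolate_apply]
  rw [eval_finsetSum]
  refine Finset.sum_congr rfl fun c _ => ?_
  rw [eval_mul, eval_C, mul_comm]
  congr 1
  simp only [Lagrange.basis, Lagrange.basisDivisor, eval_prod, eval_mul, eval_C, eval_sub, eval_X,
    eval_nodePoly]
  rw [← Finset.prod_div_distrib]
  exact Finset.prod_congr rfl fun j _ => by rw [div_eq_mul_inv, mul_comm]

lemma degree_X_pow_sub_nodePoly_lt {S : Finset ℕ} {n : ℕ} (hS : S.card = n) :
    ((X : ℝ[X]) ^ n - nodePoly S).degree < S.card := by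
  have hd : ((X : ℝ[X]) ^ n).degree = (nodePoly S).degree := by
    rw [degree_X_pow, degree_eq_natDegree (nodePoly_monic S).ne_zero, natDegree_nodePoly, hS]
  have h := degree_sub_lt_left hd (pow_ne_zero _ X_ne_zero)
    (by rw [(monic_X_pow n).leadingCoeff, (nodePoly_monic S).leadingCoeff])
  rw [degree_X_pow] at h
  rwa [hS]

end NodePoly

section Moments

open Polynomial

/-- Membership in `|S|_δ` in terms of convex weights on the vertices. -/
lemma mem_smp_iff {δ : ℕ} {S : Finset ℕ} {x : Fin δ → ℝ} :
    x ∈ smp δ S ↔ ∃ u : ℕ → ℝ, (∀ a ∈ S, 0 ≤ u a) ∧ ∑ a ∈ S, u a = 1 ∧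
      ∑ a ∈ S, u a • momCurve δ (a : ℝ) = x := by
  constructor
  · intro hx
    refine convexHull_min (t := {x | ∃ u : ℕ → ℝ, (∀ a ∈ S, 0 ≤ u a) ∧ ∑ a ∈ S, u a = 1 ∧
      ∑ a ∈ S, u a • momCurve δ (a : ℝ) = x}) ?_ ?_ hx
    · rintro _ ⟨b, hb, rfl⟩
      have hb' : b ∈ S := hb
      refine ⟨fun a => if a = b then 1 else 0, fun a _ => ?_, ?_, ?_⟩
      · dsimp only; split_ifs <;> norm_num
      · simp [hb']
      · simp [ite_smul, hb']
    · rintro _ ⟨u, hu0, hu1, rfl⟩ _ ⟨v, hv0, hv1, rfl⟩ p q hp hq hpq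
      refine ⟨fun a => p * u a + q * v a, fun a ha => ?_, ?_, ?_⟩
      · exact add_nonneg (mul_nonneg hp (hu0 a ha)) (mul_nonneg hq (hv0 a ha))
      · rw [Finset.sum_add_distrib, ← Finset.mul_sum, ← Finset.mul_sum, hu1, hv1]
        linarith
      · simp only [add_smul, mul_smul, Finset.sum_add_distrib, Finset.smul_sum]
  · rintro ⟨u, hu0, hu1, rfl⟩
    exact (convex_convexHull ℝ _).sum_mem hu0 hu1
      fun a ha => subset_convexHull ℝ _ ⟨a, ha, rfl⟩

lemma smp_mono {δ : ℕ} {A B : Finset ℕ} (h : A ⊆ B) : smp δ A ⊆ smp δ B :=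
  convexHull_mono (Set.image_mono (by exact_mod_cast h))

lemma sum_mul_eval_eq_of_sum_smul_momCurve_eq {δ : ℕ} {A B : Finset ℕ} {u v : ℕ → ℝ}
    (h1 : ∑ a ∈ A, u a = ∑ b ∈ B, v b)
    (h : ∑ a ∈ A, u a • momCurve δ (a : ℝ) = ∑ b ∈ B, v b • momCurve δ (b : ℝ))
    {f : ℝ[X]} (hf : f.natDegree < δ + 1) :
    ∑ a ∈ A, u a * f.eval (a : ℝ) = ∑ b ∈ B, v b * f.eval (b : ℝ) := by
  have key : ∀ k ∈ Finset.range (δ + 1),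
      ∑ a ∈ A, u a * (a : ℝ) ^ k = ∑ b ∈ B, v b * (b : ℝ) ^ k := by
    intro k hk
    rcases k with _ | k
    · simpa using h1
    · have hk' : k < δ := by simpa using hk
      have := congrFun h ⟨k, hk'⟩
      simpa [Finset.sum_apply, momCurve] using this
  have expand : ∀ (C : Finset ℕ) (w : ℕ → ℝ), ∑ a ∈ C, w a * f.eval (a : ℝ) =
      ∑ k ∈ Finset.range (δ + 1), f.coeff k * ∑ a ∈ C, w a * (a : ℝ) ^ k := by
    intro C w
    simp only [eval_eq_sum_range' hf, Finset.mul_sum]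
    rw [Finset.sum_comm]
    exact Finset.sum_congr rfl fun _ _ => Finset.sum_congr rfl fun _ _ => by ring
  rw [expand, expand]
  exact Finset.sum_congr rfl fun k hk => by rw [key k hk]

end Moments

section Hyperplane

open Polynomial

/-- For `F` with `δ + 1` elements, the vertical distance of `p_{δ+1}(i)` from the hyperplane
spanned by the `p_{δ+1}(f)`, `f ∈ F`, is the value at `i` of the polynomial with root set `F`. -/
lemma momCurve_sub_smul_eLast_mem_affineSpan_iff {δ : ℕ} {F : Finset ℕ} (hF : F.card = δ + 1)
    (i : ℕ) (r : ℝ) :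
    momCurve (δ + 1) (i : ℝ) - r • eLast (δ + 1) ∈ affineSpan ℝ (momPts (δ + 1) F) ↔
      r = (nodePoly F).eval (i : ℝ) := by
  have hdeg : (nodePoly F).natDegree = δ + 1 := by rw [natDegree_nodePoly, hF]
  have hlead : (nodePoly F).coeff (δ + 1) = 1 := by
    have := (nodePoly_monic F).coeff_natDegree
    rwa [hdeg] at this
  constructor
  · intro h
    let ℓ : (Fin (δ + 1) → ℝ) → ℝ := fun x =>
      (nodePoly F).coeff 0 + ∑ k : Fin (δ + 1), (nodePoly F).coeff (k.1 + 1) * x k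
    have hcurve : ∀ t : ℝ, ℓ (momCurve (δ + 1) t) = (nodePoly F).eval t := by
      intro t
      rw [eval_eq_sum_range, hdeg, Finset.sum_range_succ', Finset.sum_range]
      simp [ℓ, momCurve, add_comm]
    have hzero : ∀ x ∈ affineSpan ℝ (momPts (δ + 1) F), ℓ x = 0 := by
      intro x hx
      refine affineSpan_induction (p := fun x => ℓ x = 0) hx ?_ ?_
      · rintro _ ⟨a, ha, rfl⟩
        change ℓ (momCurve (δ + 1) (a : ℝ)) = 0
        rw [hcurve]
        exact (eval_nodePoly_eq_zero_iff F a).2 ha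
      · intro c u v w hu hv hw
        have : ℓ (c • (u -ᵥ v) +ᵥ w) = c * (ℓ u - ℓ v) + ℓ w := by
          simp only [ℓ, vsub_eq_sub, vadd_eq_add, Pi.add_apply, Pi.smul_apply, Pi.sub_apply,
            smul_eq_mul, mul_add, Finset.sum_add_distrib, mul_sub, Finset.mul_sum,
            Finset.sum_sub_distrib, mul_left_comm c]
          ring
        rw [this, hu, hv, hw]
        ring
    have hlast : ℓ (momCurve (δ + 1) (i : ℝ) - r • eLast (δ + 1)) =
        ℓ (momCurve (δ + 1) (i : ℝ)) - r := by
      have : ∑ k : Fin (δ + 1), (nodePoly F).coeff (k.1 + 1) * (r * eLast (δ + 1) k) = r := by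
        rw [Fin.sum_univ_castSucc]
        have : ∀ k : Fin δ, k.1 ≠ δ := fun k => k.2.ne
        simp [eLast, hlead, this]
      simp only [ℓ, Pi.sub_apply, Pi.smul_apply, smul_eq_mul, mul_sub, Finset.sum_sub_distrib,
        this]
      ring
    have := hzero _ h
    rw [hlast, hcurve] at this
    linarith
  · rintro rfl
    set L : ℕ → ℝ := fun c =>
      (nodePoly (F.erase c)).eval (i : ℝ) / (nodePoly (F.erase c)).eval (c : ℝ) with hL
    have hinterp : ∀ f : ℝ[X], f.degree < F.card →
        ∑ c ∈ F, L c * f.eval (c : ℝ) = f.eval (i : ℝ) :=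
      fun f hf => (eval_eq_sum_eval_nodePoly_erase hf _).symm
    have hsum : ∑ c ∈ F, L c = 1 := by
      have := hinterp 1 (by rw [degree_one, hF]; exact_mod_cast Nat.succ_pos δ)
      simpa using this
    have hpt : momCurve (δ + 1) (i : ℝ) - (nodePoly F).eval (i : ℝ) • eLast (δ + 1) =
        ∑ c ∈ F, L c • momCurve (δ + 1) (c : ℝ) := by
      ext k
      simp only [Pi.sub_apply, Pi.smul_apply, smul_eq_mul, Finset.sum_apply]
      by_cases hk : k.1 = δ
      · have := hinterp _ (degree_X_pow_sub_nodePoly_lt hF)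
        rw [eval_sub, eval_pow, eval_X] at this
        have h2 : ∀ c ∈ F, L c * (X ^ (δ + 1) - nodePoly F).eval (c : ℝ) =
            L c * momCurve (δ + 1) (c : ℝ) k := by
          intro c hc
          rw [eval_sub, eval_pow, eval_X, (eval_nodePoly_eq_zero_iff F c).2 hc, sub_zero, momCurve,
            hk]
        rw [Finset.sum_congr rfl h2] at this
        rw [this]
        simp [momCurve, eLast, hk]
      · have hk' : k.1 + 1 < δ + 1 := by have := k.2; omega
        have := hinterp (X ^ (k.1 + 1)) (by rw [degree_X_pow, hF]; exact_mod_cast hk')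
        simp only [eval_pow, eval_X] at this
        simp [momCurve, eLast, hk, this]
    rw [hpt, ← Finset.sum_coe_sort]
    have hmem := affineCombination_mem_affineSpan (k := ℝ) (s := Finset.univ)
      (w := fun c : F => L c) (by rw [Finset.sum_coe_sort]; exact hsum)
      (fun c : F => momCurve (δ + 1) ((c : ℕ) : ℝ))
    rw [Finset.affineCombination_eq_linear_combination _ _ _
      (by rw [Finset.sum_coe_sort]; exact hsum)] at hmem
    have hrange : Set.range (fun c : F => momCurve (δ + 1) ((c : ℕ) : ℝ)) = momPts (δ + 1) F := by
      rw [momPts, Set.image_eq_range]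
      rfl
    rwa [hrange] at hmem

lemma strictlyAbove_affineSpan_momPts_iff {δ : ℕ} {F : Finset ℕ} (hF : F.card = δ + 1) (i : ℕ) :
    StrictlyAbove (momCurve (δ + 1) (i : ℝ))
      ((affineSpan ℝ (momPts (δ + 1) F) : AffineSubspace ℝ (Fin (δ + 1) → ℝ)) :
        Set (Fin (δ + 1) → ℝ)) ↔ 0 < (nodePoly F).eval (i : ℝ) := by
  simp [StrictlyAbove, momCurve_sub_smul_eLast_mem_affineSpan_iff hF]

lemma strictlyBelow_affineSpan_momPts_iff {δ : ℕ} {F : Finset ℕ} (hF : F.card = δ + 1) (i : ℕ) :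
    StrictlyBelow (momCurve (δ + 1) (i : ℝ))
      ((affineSpan ℝ (momPts (δ + 1) F) : AffineSubspace ℝ (Fin (δ + 1) → ℝ)) :
        Set (Fin (δ + 1) → ℝ)) ↔ (nodePoly F).eval (i : ℝ) < 0 := by
  simp [StrictlyBelow, momCurve_sub_smul_eLast_mem_affineSpan_iff hF]

lemma mem_lowerTriang_iff {m δ : ℕ} {F : Finset ℕ} :
    F ∈ lowerTriang m δ ↔ F ⊆ Finset.Icc 1 m ∧ F.card = δ + 1 ∧
      ∀ i ∈ Finset.Icc 1 m, 0 ≤ 1 * (nodePoly F).eval (i : ℝ) := by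
  classical
  rw [lowerTriang, Finset.mem_filter, Finset.mem_powerset]
  simp only [IsLowerFacet, one_mul]
  constructor
  · rintro ⟨hF, -, hcard, h⟩
    refine ⟨hF, hcard, fun i hi => ?_⟩
    by_cases hiF : i ∈ F
    · exact ((eval_nodePoly_eq_zero_iff F i).2 hiF).ge
    · exact ((strictlyAbove_affineSpan_momPts_iff hcard i).1 (h i hi hiF)).le
  · rintro ⟨hF, hcard, h⟩
    refine ⟨hF, hF, hcard, fun i hi hiF => (strictlyAbove_affineSpan_momPts_iff hcard i).2 ?_⟩
    exact (h i hi).lt_of_ne' fun h0 => hiF ((eval_nodePoly_eq_zero_iff F i).1 h0)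

lemma mem_upperTriang_iff {m δ : ℕ} {F : Finset ℕ} :
    F ∈ upperTriang m δ ↔ F ⊆ Finset.Icc 1 m ∧ F.card = δ + 1 ∧
      ∀ i ∈ Finset.Icc 1 m, 0 ≤ (-1) * (nodePoly F).eval (i : ℝ) := by
  classical
  rw [upperTriang, Finset.mem_filter, Finset.mem_powerset]
  simp only [IsUpperFacet, neg_one_mul, Left.nonneg_neg_iff]
  constructor
  · rintro ⟨hF, -, hcard, h⟩
    refine ⟨hF, hcard, fun i hi => ?_⟩
    by_cases hiF : i ∈ F
    · exact ((eval_nodePoly_eq_zero_iff F i).2 hiF).le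
    · exact ((strictlyBelow_affineSpan_momPts_iff hcard i).1 (h i hi hiF)).le
  · rintro ⟨hF, hcard, h⟩
    refine ⟨hF, hF, hcard, fun i hi hiF => (strictlyBelow_affineSpan_momPts_iff hcard i).2 ?_⟩
    exact (h i hi).lt_of_ne fun h0 => hiF ((eval_nodePoly_eq_zero_iff F i).1 h0)

end Hyperplane

section SignedFacets

open Polynomial

lemma smp_inter_smp_of_sign {m δ : ℕ} {ε : ℝ} (hε : ε ≠ 0) {S S' : Finset ℕ}
    (hS : S ⊆ Finset.Icc 1 m) (hS' : S' ⊆ Finset.Icc 1 m)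
    (hcard : S.card = δ + 1) (hcard' : S'.card = δ + 1)
    (hsign : ∀ i ∈ Finset.Icc 1 m, 0 ≤ ε * (nodePoly S).eval (i : ℝ))
    (hsign' : ∀ i ∈ Finset.Icc 1 m, 0 ≤ ε * (nodePoly S').eval (i : ℝ)) :
    smp δ S ∩ smp δ S' = smp δ (S ∩ S') := by
  refine Set.Subset.antisymm ?_
    (Set.subset_inter (smp_mono Finset.inter_subset_left) (smp_mono Finset.inter_subset_right))
  rintro x ⟨hx, hx'⟩
  obtain ⟨u, hu0, hu1, hux⟩ := mem_smp_iff.1 hx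
  obtain ⟨v, hv0, hv1, hvx⟩ := mem_smp_iff.1 hx'
  have hdeg : (nodePoly S - nodePoly S').natDegree < δ + 1 := by
    have hd : (nodePoly S).degree = (nodePoly S').degree := by
      rw [degree_eq_natDegree (nodePoly_monic S).ne_zero,
        degree_eq_natDegree (nodePoly_monic S').ne_zero, natDegree_nodePoly, natDegree_nodePoly,
        hcard, hcard']
    have h := degree_sub_lt_left hd (nodePoly_monic S).ne_zero
      (by rw [(nodePoly_monic S).leadingCoeff, (nodePoly_monic S').leadingCoeff])
    rw [degree_eq_natDegree (nodePoly_monic S).ne_zero, natDegree_nodePoly, hcard] at h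
    rcases eq_or_ne (nodePoly S - nodePoly S') 0 with h0 | h0
    · simp [h0]
    · exact (natDegree_lt_iff_degree_lt h0).2 h
  have hmom := sum_mul_eval_eq_of_sum_smul_momCurve_eq (hu1.trans hv1.symm) (hux.trans hvx.symm)
    hdeg
  simp only [eval_sub, mul_sub, Finset.sum_sub_distrib] at hmom
  have hz : ∑ a ∈ S, u a * (nodePoly S).eval (a : ℝ) = 0 := Finset.sum_eq_zero fun a ha => by
    rw [(eval_nodePoly_eq_zero_iff S a).2 ha, mul_zero]
  have hz' : ∑ a ∈ S', v a * (nodePoly S').eval (a : ℝ) = 0 := Finset.sum_eq_zero fun a ha => by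
    rw [(eval_nodePoly_eq_zero_iff S' a).2 ha, mul_zero]
  have hnn : ∀ a ∈ S, 0 ≤ u a * (ε * (nodePoly S').eval (a : ℝ)) :=
    fun a ha => mul_nonneg (hu0 a ha) (hsign' a (hS ha))
  have hnn' : 0 ≤ ∑ a ∈ S', v a * (ε * (nodePoly S).eval (a : ℝ)) :=
    Finset.sum_nonneg fun a ha => mul_nonneg (hv0 a ha) (hsign a (hS' ha))
  have hsum : ∑ a ∈ S, u a * (ε * (nodePoly S').eval (a : ℝ)) = 0 := by
    refine le_antisymm ?_ (Finset.sum_nonneg hnn)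
    simp only [mul_left_comm _ ε, ← Finset.mul_sum] at hnn' ⊢
    have : ε * ∑ a ∈ S, u a * (nodePoly S').eval (a : ℝ) =
        - (ε * ∑ a ∈ S', v a * (nodePoly S).eval (a : ℝ)) := by
      rw [← mul_neg]
      congr 1
      linarith
    linarith
  have hsupp : ∀ a ∈ S, a ∉ S ∩ S' → u a = 0 := by
    intro a ha ha'
    have h0 := (Finset.sum_eq_zero_iff_of_nonneg hnn).1 hsum a ha
    have hne : ε * (nodePoly S').eval (a : ℝ) ≠ 0 := mul_ne_zero hε fun h =>
      ha' (Finset.mem_inter.2 ⟨ha, (eval_nodePoly_eq_zero_iff S' a).1 h⟩)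
    exact (mul_eq_zero.1 h0).resolve_right hne
  refine mem_smp_iff.2 ⟨u, fun a ha => hu0 a (Finset.mem_inter.1 ha).1, ?_, ?_⟩
  · rw [← hu1]
    exact Finset.sum_subset Finset.inter_subset_left hsupp
  · rw [← hux]
    exact Finset.sum_subset Finset.inter_subset_left fun a ha ha' => by
      rw [hsupp a ha ha', zero_smul]

/-- Replacing `c` by a suitable `a` keeps the sign condition and decreases the height of the
lifted point, provided that `c` has a negative barycentric coordinate. -/
lemma exists_exchange_of_sign {m : ℕ} {ε σ : ℝ} (hε : ε ≠ 0) {S : Finset ℕ} {u : ℕ → ℝ}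
    (hu0 : ∀ a ∈ Finset.Icc 1 m, 0 ≤ u a)
    (hsign : ∀ i ∈ Finset.Icc 1 m, 0 ≤ ε * (nodePoly S).eval (i : ℝ)) {c : ℕ} (hc : c ∈ S)
    (hσ : ∑ a ∈ Finset.Icc 1 m, u a * (nodePoly (S.erase c)).eval (a : ℝ) = σ)
    (hneg : σ * (nodePoly (S.erase c)).eval (c : ℝ) < 0) :
    ∃ a ∈ Finset.Icc 1 m, a ∉ S.erase c ∧
      (∀ i ∈ Finset.Icc 1 m, 0 ≤ ε * (nodePoly (insert a (S.erase c))).eval (i : ℝ)) ∧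
      ∑ i ∈ Finset.Icc 1 m, u i * (ε * (nodePoly (insert a (S.erase c))).eval (i : ℝ)) <
        ∑ i ∈ Finset.Icc 1 m, u i * (ε * (nodePoly S).eval (i : ℝ)) := by
  set g : ℕ → ℝ := fun t => (nodePoly (S.erase c)).eval (t : ℝ) with hg
  have hσ0 : σ ≠ 0 := by rintro rfl; simp at hneg
  have hSg : ∀ t : ℕ, (nodePoly S).eval (t : ℝ) = ((t : ℝ) - c) * g t := fun t => by
    rw [← eval_nodePoly_insert (Finset.notMem_erase c S), Finset.insert_erase hc]
  have hpos : ∀ t ∈ Finset.Icc 1 m, 0 < σ * g t → 0 < ε * σ * ((t : ℝ) - c) := by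
    intro t ht hgt
    have htc : t ≠ c := by rintro rfl; exact lt_asymm hneg hgt
    have htc' : (t : ℝ) - c ≠ 0 := sub_ne_zero.2 (by exact_mod_cast htc)
    have h1 := hsign t ht
    rw [hSg] at h1
    have h2 : 0 ≤ (ε * σ * ((t : ℝ) - c)) * (σ * g t) := by
      have := mul_nonneg (mul_self_nonneg σ) h1
      linarith
    exact (nonneg_of_mul_nonneg_left h2 hgt).lt_of_ne'
      (mul_ne_zero (mul_ne_zero hε hσ0) htc')
  obtain ⟨a, ha, hmin⟩ : ∃ a ∈ (Finset.Icc 1 m).filter (fun t => 0 < σ * g t),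
      ∀ t ∈ (Finset.Icc 1 m).filter (fun t => 0 < σ * g t), ε * σ * (a : ℝ) ≤ ε * σ * (t : ℝ) := by
    refine Finset.exists_min_image _ _ ?_
    by_contra hempty
    rw [Finset.not_nonempty_iff_eq_empty, Finset.filter_eq_empty_iff] at hempty
    have : σ * σ ≤ 0 := by
      nth_rewrite 2 [← hσ]
      rw [Finset.mul_sum]
      refine Finset.sum_nonpos fun t ht => ?_
      have h1 := mul_nonneg (hu0 t ht) (neg_nonneg.2 (not_lt.1 (hempty ht)))
      change σ * (u t * g t) ≤ 0
      linarith
    exact absurd (mul_self_pos.2 hσ0) this.not_gt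
  obtain ⟨ham, hag⟩ := Finset.mem_filter.1 ha
  have haR : a ∉ S.erase c := fun h => by
    rw [hg] at hag
    simp [(eval_nodePoly_eq_zero_iff _ a).2 h] at hag
  have hac := hpos a ham hag
  refine ⟨a, ham, haR, fun t ht => ?_, ?_⟩
  · rw [eval_nodePoly_insert haR]
    change 0 ≤ ε * (((t : ℝ) - a) * g t)
    have hσσ : 0 < σ * σ := mul_self_pos.2 hσ0
    refine nonneg_of_mul_nonneg_right (b := ε * (((t : ℝ) - a) * g t)) ?_ hσσ
    have key : 0 ≤ (ε * σ * ((t : ℝ) - a)) * (σ * g t) := by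
      rcases lt_trichotomy (σ * g t) 0 with h | h | h
      · have h1 := hsign t ht
        rw [hSg] at h1
        have h2 : 0 ≤ (ε * σ * ((t : ℝ) - c)) * (σ * g t) := by
          have := mul_nonneg hσσ.le h1
          linarith
        have h3 : ε * σ * ((t : ℝ) - c) ≤ 0 := nonpos_of_mul_nonneg_left h2 h
        exact mul_nonneg_of_nonpos_of_nonpos (by linarith) h.le
      · rw [h, mul_zero]
      · have := hmin t (Finset.mem_filter.2 ⟨ht, h⟩)
        exact mul_nonneg (by linarith) h.le
    linarith
  · have hdiff : ∑ i ∈ Finset.Icc 1 m, u i * (ε * (nodePoly S).eval (i : ℝ)) -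
        ∑ i ∈ Finset.Icc 1 m, u i * (ε * (nodePoly (insert a (S.erase c))).eval (i : ℝ)) =
        ε * ((a : ℝ) - c) * σ := by
      rw [← Finset.sum_sub_distrib, ← hσ, Finset.mul_sum]
      refine Finset.sum_congr rfl fun t _ => ?_
      rw [hSg, eval_nodePoly_insert haR]
      ring
    linarith

/-- The sets satisfying a sign condition form a triangulation as soon as there is one of them. -/
theorem isTriangulation_of_sign {m δ : ℕ} {ε : ℝ} (hε : ε ≠ 0) {T : Finset (Finset ℕ)}
    (hT : ∀ S, S ∈ T ↔ S ⊆ Finset.Icc 1 m ∧ S.card = δ + 1 ∧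
      ∀ i ∈ Finset.Icc 1 m, 0 ≤ ε * (nodePoly S).eval (i : ℝ))
    (hne : T.Nonempty) : IsTriangulation m δ T := by
  refine ⟨fun S hS => ⟨((hT S).1 hS).1, ((hT S).1 hS).2.1⟩, ?_, fun S hS S' hS' => ?_⟩
  · refine Set.Subset.antisymm
      (Set.iUnion₂_subset fun S hS => smp_mono ((hT S).1 hS).1) fun x hx => ?_
    obtain ⟨u, hu0, hu1, hux⟩ := mem_smp_iff.1 hx
    obtain ⟨S, hS, hmin⟩ := Finset.exists_min_image T (fun S =>
      ∑ i ∈ Finset.Icc 1 m, u i * (ε * (nodePoly S).eval (i : ℝ))) hne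
    obtain ⟨hSm, hcard, hsign⟩ := (hT S).1 hS
    refine Set.mem_iUnion₂.2 ⟨S, hS, ?_⟩
    set w : ℕ → ℝ := fun c =>
      (∑ a ∈ Finset.Icc 1 m, u a * (nodePoly (S.erase c)).eval (a : ℝ)) /
        (nodePoly (S.erase c)).eval (c : ℝ) with hw
    have hinterp : ∀ f : ℝ[X], f.degree < S.card →
        ∑ c ∈ S, w c * f.eval (c : ℝ) = ∑ a ∈ Finset.Icc 1 m, u a * f.eval (a : ℝ) := by
      intro f hf
      have hexp : ∀ a ∈ Finset.Icc 1 m, u a * f.eval (a : ℝ) = ∑ c ∈ S,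
          u a * (((nodePoly (S.erase c)).eval (a : ℝ) / (nodePoly (S.erase c)).eval (c : ℝ)) *
            f.eval (c : ℝ)) := fun a _ => by
        rw [← Finset.mul_sum, ← eval_eq_sum_eval_nodePoly_erase hf]
      rw [Finset.sum_congr rfl hexp, Finset.sum_comm]
      refine Finset.sum_congr rfl fun c _ => ?_
      simp only [hw]
      rw [Finset.sum_div, Finset.sum_mul]
      exact Finset.sum_congr rfl fun a _ => by ring
    refine mem_smp_iff.2 ⟨w, fun c hc => ?_, ?_, ?_⟩
    · by_contra! hlt
      have hc0 : (nodePoly (S.erase c)).eval (c : ℝ) ≠ 0 := fun h =>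
        Finset.notMem_erase c S ((eval_nodePoly_eq_zero_iff _ c).1 h)
      have hneg : (∑ a ∈ Finset.Icc 1 m, u a * (nodePoly (S.erase c)).eval (a : ℝ)) *
          (nodePoly (S.erase c)).eval (c : ℝ) < 0 := by
        have h1 := mul_neg_of_neg_of_pos hlt (mul_self_pos.2 hc0)
        rwa [hw, ← mul_assoc, div_mul_cancel₀ _ hc0] at h1
      obtain ⟨a, ham, haR, hsign', hlt'⟩ := exists_exchange_of_sign hε hu0 hsign hc rfl hneg
      refine (hmin _ ((hT _).2 ⟨?_, ?_, hsign'⟩)).not_gt hlt'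
      · exact Finset.insert_subset ham ((Finset.erase_subset _ _).trans hSm)
      · rw [Finset.card_insert_of_notMem haR, Finset.card_erase_add_one hc, hcard]
    · have := hinterp 1 (by rw [degree_one, hcard]; exact_mod_cast Nat.succ_pos δ)
      simpa [hu1] using this
    · rw [← hux]
      ext k
      have := hinterp (X ^ (k.1 + 1)) (by
        rw [degree_X_pow, hcard]; exact_mod_cast Nat.succ_lt_succ k.2)
      simpa [Finset.sum_apply, momCurve] using this
  · obtain ⟨h1, h2, h3⟩ := (hT S).1 hS
    obtain ⟨h1', h2', h3'⟩ := (hT S').1 hS'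
    exact smp_inter_smp_of_sign hε h1 h1' h2 h2' h3 h3'

end SignedFacets

lemma lowerTriang_nonempty {δ m : ℕ} (hm : δ + 2 ≤ m) : (lowerTriang m δ).Nonempty := by
  refine ⟨Finset.Icc 1 (δ + 1), mem_lowerTriang_iff.2 ⟨?_, by simp, fun i hi => ?_⟩⟩
  · exact Finset.Icc_subset_Icc le_rfl (by omega)
  · rw [one_mul]
    by_cases hiF : i ∈ Finset.Icc 1 (δ + 1)
    · exact ((eval_nodePoly_eq_zero_iff _ i).2 hiF).ge
    · rw [eval_nodePoly]
      refine Finset.prod_nonneg fun a ha => sub_nonneg.2 ?_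
      simp only [Finset.mem_Icc] at hi hiF ha
      exact_mod_cast (by omega : a ≤ i)

lemma upperTriang_nonempty {δ m : ℕ} (hm : δ + 2 ≤ m) : (upperTriang m δ).Nonempty := by
  have hmF : m ∉ Finset.Icc 1 δ := by simp; omega
  refine ⟨insert m (Finset.Icc 1 δ), mem_upperTriang_iff.2 ⟨?_, ?_, fun i hi => ?_⟩⟩
  · exact Finset.insert_subset (by simp; omega) (Finset.Icc_subset_Icc le_rfl (by omega))
  · rw [Finset.card_insert_of_notMem hmF]
    simp
  · rw [eval_nodePoly_insert hmF, neg_one_mul, neg_nonneg]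
    have him : (i : ℝ) ≤ m := by exact_mod_cast (Finset.mem_Icc.1 hi).2
    refine mul_nonpos_of_nonpos_of_nonneg (sub_nonpos.2 him) ?_
    by_cases hiF : i ∈ Finset.Icc 1 δ
    · exact ((eval_nodePoly_eq_zero_iff _ i).2 hiF).ge
    · rw [eval_nodePoly]
      refine Finset.prod_nonneg fun a ha => sub_nonneg.2 ?_
      simp only [Finset.mem_Icc] at hi hiF ha
      exact_mod_cast (by omega : a ≤ i)

/-- the lower and the upper triangulations of `C(m, δ)` are indeed
triangulations of `C(m, δ)`. -/
theorem statement8 (δ m : ℕ) (hδ : 1 ≤ δ) (hm : δ + 2 ≤ m) :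
    IsTriangulation m δ (lowerTriang m δ) ∧ IsTriangulation m δ (upperTriang m δ) := by
  exact ⟨isTriangulation_of_sign one_ne_zero (fun _ => mem_lowerTriang_iff)
      (lowerTriang_nonempty hm),
    isTriangulation_of_sign (neg_ne_zero.2 one_ne_zero) (fun _ => mem_upperTriang_iff)
      (upperTriang_nonempty hm)⟩
end
end

section
/- Let d ≥ 1 and m ≥ 2d+1 be integers, let 𝒯 be a triangulation of the cyclic polytope C(m, 2d), and let A be a (d+1)-element subset of {1, …, m}. Then the d-simplex |A|_{2d} is submerged by 𝒯 if and only if there is no d-face B of 𝒯 with B ≀ A. -/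
open Finset

noncomputable section

theorem lastCoord_succ {δ : ℕ} (x : Fin (δ + 1) → ℝ) : lastCoord x = x (Fin.last δ) := by
  simp only [lastCoord, Nat.succ_pos, dif_pos]
  rfl

theorem lastCoord_sum_smul_momCurve (δ : ℕ) (S : Finset ℕ) (w : ℕ → ℝ) :
    lastCoord (∑ n ∈ S, w n • momCurve (δ + 1) (n : ℝ)) = ∑ n ∈ S, w n * (n : ℝ) ^ (δ + 1) := by
  simp [lastCoord_succ, momCurve]

/-- Equality of affine combinations on the moment curve is equality of power moments. -/
theorem sum_smul_momCurve_eq_iff {ι κ : Type*} (δ : ℕ) (s : Finset ι) (t : Finset κ)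
    (w : ι → ℝ) (v : κ → ℝ) (x : ι → ℝ) (y : κ → ℝ) (h : ∑ i ∈ s, w i = ∑ j ∈ t, v j) :
    ∑ i ∈ s, w i • momCurve δ (x i) = ∑ j ∈ t, v j • momCurve δ (y j) ↔
      ∀ k ≤ δ, ∑ i ∈ s, w i * x i ^ k = ∑ j ∈ t, v j * y j ^ k := by
  constructor
  · intro H k hk
    rcases k with _ | k
    · simpa using h
    · simpa [momCurve] using congrFun H ⟨k, hk⟩
  · intro H
    ext k
    simpa [momCurve] using H (k + 1) k.2

/-- The sum of the fibrewise weights of `c` along `g`. -/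
def pushWeight {ι : Type*} [Fintype ι] (g : ι → ℕ) (c : ι → ℝ) (n : ℕ) : ℝ :=
  ∑ i, if g i = n then c i else 0

theorem pushWeight_nonneg {ι : Type*} [Fintype ι] {g : ι → ℕ} {c : ι → ℝ} (hc : ∀ i, 0 ≤ c i)
    (n : ℕ) : 0 ≤ pushWeight g c n :=
  Finset.sum_nonneg fun i _ => by split_ifs; exacts [hc i, le_rfl]

theorem sum_pushWeight_smul {ι E : Type*} [Fintype ι] [AddCommGroup E] [Module ℝ E] {g : ι → ℕ}
    {S : Finset ℕ} (hg : ∀ i, g i ∈ S) (c : ι → ℝ) (f : ℕ → E) :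
    ∑ n ∈ S, pushWeight g c n • f n = ∑ i, c i • f (g i) := by
  simp only [pushWeight, Finset.sum_smul]
  rw [Finset.sum_comm]
  refine Finset.sum_congr rfl fun i _ => ?_
  rw [Finset.sum_eq_single (g i)]
  · simp
  · intro n _ hn
    simp [hn.symm]
  · exact fun h => absurd (hg i) h

theorem isLift_pushWeight {ι : Type*} [Fintype ι] {g : ι → ℕ} {S : Finset ℕ} (hg : ∀ i, g i ∈ S)
    {c : ι → ℝ} (hc : ∀ i, 0 ≤ c i) (hc1 : ∑ i, c i = 1) (δ : ℕ) :
    IsLift δ S (∑ i, c i • momCurve δ (g i : ℝ)) (∑ i, c i • momCurve (δ + 1) (g i : ℝ)) :=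
  ⟨pushWeight g c, fun n _ => pushWeight_nonneg hc n,
    by simpa [hc1] using sum_pushWeight_smul hg c (fun _ => (1 : ℝ)),
    sum_pushWeight_smul hg c _, sum_pushWeight_smul hg c _⟩

theorem sum_smul_momCurve_mem_smp {ι : Type*} [Fintype ι] {g : ι → ℕ} {S : Finset ℕ}
    (hg : ∀ i, g i ∈ S) {c : ι → ℝ} (hc : ∀ i, 0 ≤ c i) (hc1 : ∑ i, c i = 1) (δ : ℕ) :
    ∑ i, c i • momCurve δ (g i : ℝ) ∈ smp δ S :=
  (convex_convexHull ℝ _).sum_mem (fun i _ => hc i) hc1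
    fun i _ => subset_convexHull ℝ _ ⟨g i, hg i, rfl⟩

/-- Two interlacing families of `d + 1` reals carry positive measures with equal moments up to
order `2d`, the family containing the largest point having the larger next moment. -/
theorem exists_interlacing_weights (d : ℕ) (a b : Fin (d + 1) → ℝ) (hba : ∀ i j, i ≤ j → b i < a j)
    (hab : ∀ i j, i < j → a i < b j) (ha : StrictMono a) (hb : StrictMono b) :
    ∃ α β : Fin (d + 1) → ℝ, (∀ i, 0 < α i) ∧ (∀ i, 0 < β i) ∧
      (∀ k ≤ 2 * d, ∑ i, α i * a i ^ k = ∑ i, β i * b i ^ k) ∧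
      ∑ i, β i * b i ^ (2 * d + 1) < ∑ i, α i * a i ^ (2 * d + 1) := by
  set v : Fin (d + 1) ⊕ Fin (d + 1) → ℝ := Sum.elim a b with hv
  have hne : ∀ i j, a i ≠ b j := fun i j => by
    rcases lt_or_ge i j with h | h
    · exact (hab i j h).ne
    · exact (hba j i h).ne'
  have hinj : Function.Injective v := by
    rintro (i | i) (j | j) h
    · exact congrArg _ (ha.injective h)
    · exact absurd h (hne i j)
    · exact absurd h.symm (hne j i)
    · exact congrArg _ (hb.injective h)
  have key : ∀ k ≤ 2 * d + 1, (if k = 2 * d + 1 then (1 : ℝ) else 0) =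
      ∑ i, v i ^ k / ∏ j ∈ univ.erase i, (v i - v j) := by
    intro k hk
    have hcard : #(univ : Finset (Fin (d + 1) ⊕ Fin (d + 1))) = 2 * d + 2 := by
      simp; ring
    have h := Lagrange.coeff_eq_sum (s := univ) (v := v) hinj.injOn
      (P := (Polynomial.X : Polynomial ℝ) ^ k)
      (by rw [Polynomial.degree_X_pow, hcard]; exact_mod_cast (by omega))
    rw [hcard, Polynomial.coeff_X_pow] at h
    simpa [eq_comm] using h
  have hA : ∀ i, 0 < ∏ j ∈ univ.erase (Sum.inl i), (v (Sum.inl i) - v j) := by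
    intro i
    have : ∏ j ∈ univ.erase (Sum.inl i), (v (Sum.inl i) - v j) =
        ∏ j, (if j = i then 1 else a i - a j) * (a i - b j) := by
      rw [Finset.prod_mul_distrib, ← Finset.filter_ne' univ, Finset.prod_filter,
        Fintype.prod_sum_type]
      simp [hv, ite_not]
    rw [this]
    refine Finset.prod_pos fun j _ => ?_
    rcases lt_trichotomy j i with h | rfl | h
    · rw [if_neg h.ne]
      exact mul_pos (sub_pos.2 (ha h)) (sub_pos.2 (hba _ _ h.le))
    · simpa using hba j j le_rfl
    · rw [if_neg h.ne']
      exact mul_pos_of_neg_of_neg (sub_neg.2 (ha h)) (sub_neg.2 (hab _ _ h))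
  have hB : ∀ i, ∏ j ∈ univ.erase (Sum.inr i), (v (Sum.inr i) - v j) < 0 := by
    intro i
    have : ∏ j ∈ univ.erase (Sum.inr i), (v (Sum.inr i) - v j) =
        ∏ j, (b i - a j) * (if j = i then 1 else b i - b j) := by
      rw [Finset.prod_mul_distrib, ← Finset.filter_ne' univ, Finset.prod_filter,
        Fintype.prod_sum_type]
      simp [hv, ite_not]
    rw [this, ← Finset.mul_prod_erase _ _ (Finset.mem_univ i)]
    refine mul_neg_of_neg_of_pos (by simpa using hba i i le_rfl) (Finset.prod_pos fun j hj => ?_)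
    rcases lt_or_gt_of_ne (Finset.ne_of_mem_erase hj) with h | h
    · rw [if_neg h.ne]
      exact mul_pos (sub_pos.2 (hab _ _ h)) (sub_pos.2 (hb h))
    · rw [if_neg h.ne']
      exact mul_pos_of_neg_of_neg (sub_neg.2 (hba _ _ h.le)) (sub_neg.2 (hb h))
  have split : ∀ k ≤ 2 * d + 1, (if k = 2 * d + 1 then (1 : ℝ) else 0) =
      ∑ i, (∏ j ∈ univ.erase (Sum.inl i), (v (Sum.inl i) - v j))⁻¹ * a i ^ k -
        ∑ i, -(∏ j ∈ univ.erase (Sum.inr i), (v (Sum.inr i) - v j))⁻¹ * b i ^ k := by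
    intro k hk
    rw [key k hk, Fintype.sum_sum_type, sub_eq_add_neg, ← Finset.sum_neg_distrib]
    congr 1 <;> refine Finset.sum_congr rfl fun i _ => ?_ <;> simp [hv, div_eq_inv_mul]
  refine ⟨_, _, fun i => inv_pos.2 (hA i), fun i => neg_pos.2 (inv_neg''.2 (hB i)), ?_, ?_⟩
  · intro k hk
    have := split k (by omega)
    rw [if_neg (by omega)] at this
    linarith
  · have := split (2 * d + 1) le_rfl
    rw [if_pos rfl] at this
    linarith

theorem sum_mul_eval_monic {ι : Type*} {n : ℕ} {P : Polynomial ℝ} (hP : P.Monic)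
    (hdeg : P.natDegree = n + 1) (s : Finset ι) (w : ι → ℝ) (x : ι → ℝ) :
    ∑ i ∈ s, w i * P.eval (x i) = ∑ i ∈ s, w i * x i ^ (n + 1) +
      ∑ k ∈ range (n + 1), P.coeff k * ∑ i ∈ s, w i * x i ^ k := by
  simp only [Finset.mul_sum]
  rw [Finset.sum_comm, ← Finset.sum_add_distrib]
  refine Finset.sum_congr rfl fun i _ => ?_
  rw [Polynomial.eval_eq_sum_range, hdeg, Finset.sum_range_succ, ← hdeg, hP.coeff_natDegree,
    hdeg, mul_add, Finset.mul_sum, add_comm, one_mul]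
  congr 1
  exact Finset.sum_congr rfl fun k _ => by ring

/-- If two weighted families have equal moments up to order `n` and the first has the larger
moment of order `n + 1`, then no monic polynomial of degree `n + 1` vanishing on the first family
is nonnegative on the second. -/
theorem exists_eval_neg_of_moments {ι κ : Type*} (n : ℕ) (s : Finset ι) (t : Finset κ)
    (w : ι → ℝ) (v : κ → ℝ) (x : ι → ℝ) (y : κ → ℝ) (hv : ∀ j ∈ t, 0 ≤ v j)
    (h : ∀ k ≤ n, ∑ i ∈ s, w i * x i ^ k = ∑ j ∈ t, v j * y j ^ k)
    (hlt : ∑ j ∈ t, v j * y j ^ (n + 1) < ∑ i ∈ s, w i * x i ^ (n + 1))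
    {P : Polynomial ℝ} (hP : P.Monic) (hdeg : P.natDegree = n + 1)
    (hs : ∀ i ∈ s, P.eval (x i) = 0) : ∃ j ∈ t, P.eval (y j) < 0 := by
  by_contra! hcon
  have e1 := sum_mul_eval_monic hP hdeg s w x
  have e2 := sum_mul_eval_monic hP hdeg t v y
  rw [Finset.sum_eq_zero fun i hi => by rw [hs i hi, mul_zero]] at e1
  have e3 : ∑ k ∈ range (n + 1), P.coeff k * ∑ i ∈ s, w i * x i ^ k =
      ∑ k ∈ range (n + 1), P.coeff k * ∑ j ∈ t, v j * y j ^ k :=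
    Finset.sum_congr rfl fun k hk => by rw [h k (Nat.lt_succ_iff.1 (Finset.mem_range.1 hk))]
  have e4 : 0 ≤ ∑ j ∈ t, v j * P.eval (y j) :=
    Finset.sum_nonneg fun j hj => mul_nonneg (hv j hj) (hcon j hj)
  linarith

/-- For each `i` there is a monic polynomial of degree `2d + 1` vanishing at all `a j` whose
negative values on `[0, ∞)` are only attained between `a (i - 1)` and `a i`. -/
theorem exists_monic_vanishing (d : ℕ) {a : Fin (d + 1) → ℝ} (ha : StrictMono a)
    (i : Fin (d + 1)) :
    ∃ P : Polynomial ℝ, P.Monic ∧ P.natDegree = 2 * d + 1 ∧ (∀ j, P.eval (a j) = 0) ∧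
      ∀ t, 0 ≤ t → P.eval t < 0 → t < a i ∧ ∀ j < i, a j < t := by
  have hmonic : ∀ s : Finset (Fin (d + 1)),
      (∏ j ∈ s, (Polynomial.X - Polynomial.C (a j)) ^ 2).Monic := fun s =>
    Polynomial.monic_prod_of_monic _ _ fun j _ => (Polynomial.monic_X_sub_C _).pow 2
  have hdegree : ∀ s : Finset (Fin (d + 1)),
      (∏ j ∈ s, (Polynomial.X - Polynomial.C (a j)) ^ 2).natDegree = 2 * #s := fun s => by
    rw [Polynomial.natDegree_prod_of_monic _ _ fun j _ => (Polynomial.monic_X_sub_C _).pow 2]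
    simp [mul_comm]
  have heval : ∀ (s : Finset (Fin (d + 1))) (t : ℝ),
      0 ≤ (∏ j ∈ s, (Polynomial.X - Polynomial.C (a j)) ^ 2).eval t := fun s t => by
    rw [Polynomial.eval_prod]
    exact Finset.prod_nonneg fun j _ => by simpa using sq_nonneg _
  have hzero : ∀ (s : Finset (Fin (d + 1))), ∀ j ∈ s,
      (∏ j ∈ s, (Polynomial.X - Polynomial.C (a j)) ^ 2).eval (a j) = 0 := fun s j hj => by
    rw [Polynomial.eval_prod]
    exact Finset.prod_eq_zero hj (by simp)
  rcases Fin.eq_zero_or_eq_succ i with rfl | ⟨k, rfl⟩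
  · refine ⟨(Polynomial.X - Polynomial.C (a 0)) *
      ∏ j ∈ univ.erase 0, (Polynomial.X - Polynomial.C (a j)) ^ 2,
      (Polynomial.monic_X_sub_C _).mul (hmonic _), ?_, ?_, ?_⟩
    · rw [(Polynomial.monic_X_sub_C _).natDegree_mul (hmonic _), hdegree]
      simp [add_comm]
    · intro j
      rw [Polynomial.eval_mul]
      by_cases hj : j = 0
      · simp [hj]
      · rw [hzero _ j (by simp [hj]), mul_zero]
    · intro t _ hneg
      refine ⟨?_, fun j hj => absurd hj (Fin.not_lt_zero j)⟩
      by_contra! hcon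
      rw [Polynomial.eval_mul] at hneg
      exact hneg.not_ge (mul_nonneg (by simpa using hcon) (heval _ t))
  · have hne : k.succ ≠ k.castSucc := (Fin.castSucc_lt_succ (i := k)).ne'
    have hm2 := (Polynomial.monic_X_sub_C (a k.castSucc)).mul
      (Polynomial.monic_X_sub_C (a k.succ))
    have hm3 := Polynomial.monic_X.mul hm2
    refine ⟨Polynomial.X * ((Polynomial.X - Polynomial.C (a k.castSucc)) *
      (Polynomial.X - Polynomial.C (a k.succ))) *
      ∏ j ∈ (univ.erase k.castSucc).erase k.succ, (Polynomial.X - Polynomial.C (a j)) ^ 2,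
      hm3.mul (hmonic _), ?_, ?_, ?_⟩
    · rw [hm3.natDegree_mul (hmonic _), Polynomial.monic_X.natDegree_mul hm2,
        (Polynomial.monic_X_sub_C _).natDegree_mul (Polynomial.monic_X_sub_C _), hdegree,
        Finset.card_erase_of_mem (by simp [hne]), Finset.card_erase_of_mem (Finset.mem_univ _)]
      have := k.pos
      simp only [Polynomial.natDegree_X, Polynomial.natDegree_X_sub_C, Finset.card_univ,
        Fintype.card_fin]
      omega
    · intro j
      rw [Polynomial.eval_mul]
      by_cases hj : j = k.castSucc
      · simp [hj]
      by_cases hj' : j = k.succ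
      · simp [hj']
      rw [hzero _ j (by simp [hj, hj']), mul_zero]
    · intro t ht hneg
      have hlt : (t - a k.castSucc) * (t - a k.succ) < 0 := by
        by_contra! hcon
        rw [Polynomial.eval_mul] at hneg
        refine hneg.not_ge (mul_nonneg ?_ (heval _ t))
        simpa using mul_nonneg ht hcon
      have hk := ha (Fin.castSucc_lt_succ (i := k))
      have h1 : t < a k.succ := by nlinarith
      have h2 : a k.castSucc < t := by nlinarith
      exact ⟨h1, fun j hj => (ha.monotone (Fin.le_castSucc_iff.2 hj)).trans_lt h2⟩

/-- `|A|_{2d}` is submerged by `T` iff there is no `d`-face `B` of `T`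
with `B ≀ A`. -/
theorem statement12 (d m : ℕ) (hd : 1 ≤ d) (hm : 2 * d + 1 ≤ m)
    (T : Finset (Finset ℕ)) (hT : IsTriangulation m (2 * d) T)
    (A : Finset ℕ) (hA : A ⊆ Finset.Icc 1 m) (hAc : A.card = d + 1) :
    Submerged (2 * d) T A ↔
      ¬ ∃ B : Finset ℕ, B.card = d + 1 ∧ IsFace T B ∧ Intertwines d B A := by
  constructor
  · rintro hsub ⟨_, -, ⟨S, hS, hBS⟩, b, a, hb, ha, rfl, rfl, hba, hab⟩
    have hbS : ∀ i, b i ∈ S := fun i => hBS (Finset.mem_image_of_mem b (Finset.mem_univ i))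
    have haA : ∀ i, a i ∈ Finset.image a Finset.univ := fun i =>
      Finset.mem_image_of_mem a (Finset.mem_univ i)
    have hba' : ∀ i j, i ≤ j → b i < a j := fun i j hij => (hba i).trans_le (ha.monotone hij)
    have hab' : ∀ i j, i < j → a i < b j := by
      intro i j hij
      obtain ⟨i, rfl⟩ := Fin.exists_castSucc_eq.2 (hij.trans_le (Fin.le_last j)).ne
      exact (hab i).trans_le (hb.monotone (Fin.castSucc_lt_iff_succ_le.1 hij))
    obtain ⟨α, β, hα, hβ, heq, hlt⟩ := exists_interlacing_weights d (fun i => (a i : ℝ))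
      (fun i => (b i : ℝ)) (fun i j h => by exact_mod_cast hba' i j h)
      (fun i j h => by exact_mod_cast hab' i j h) (Nat.strictMono_cast.comp ha)
      (Nat.strictMono_cast.comp hb)
    set W : ℝ := ∑ i, α i
    have hWpos : 0 < W := Finset.sum_pos (fun i _ => hα i) Finset.univ_nonempty
    have hW' : ∑ i, β i = W := by simpa using (heq 0 (Nat.zero_le _)).symm
    have hα1 : ∑ i, α i / W = 1 := by rw [← Finset.sum_div, div_self hWpos.ne']
    have hβ1 : ∑ i, β i / W = 1 := by rw [← Finset.sum_div, hW', div_self hWpos.ne']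
    have hα0 : ∀ i, 0 ≤ α i / W := fun i => (div_pos (hα i) hWpos).le
    have hβ0 : ∀ i, 0 ≤ β i / W := fun i => (div_pos (hβ i) hWpos).le
    have hx : ∑ i, (α i / W) • momCurve (2 * d) (a i : ℝ) =
        ∑ i, (β i / W) • momCurve (2 * d) (b i : ℝ) := by
      refine (sum_smul_momCurve_eq_iff (2 * d) univ univ _ _ (fun i => (a i : ℝ))
        (fun i => (b i : ℝ)) (hα1.trans hβ1.symm)).2 fun k hk => ?_
      simp only [div_mul_eq_mul_div, ← Finset.sum_div, heq k hk]
    have hle := hsub S hS _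
      ⟨sum_smul_momCurve_mem_smp haA hα0 hα1 _,
        hx ▸ sum_smul_momCurve_mem_smp hbS hβ0 hβ1 _⟩ _ _
      (isLift_pushWeight haA hα0 hα1 _) (hx ▸ isLift_pushWeight hbS hβ0 hβ1 _)
    refine hle.not_gt ?_
    simp only [lastCoord_succ, Finset.sum_apply, Pi.smul_apply, smul_eq_mul, momCurve,
      Fin.val_last, div_mul_eq_mul_div, ← Finset.sum_div]
    exact div_lt_div_of_pos_right hlt hWpos
  · intro hB S hS x _ y y' hy hy'
    obtain ⟨w, -, hw1, hwx, rfl⟩ := hy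
    obtain ⟨v, hv0, hv1, hvx, rfl⟩ := hy'
    by_contra! hlt
    rw [lastCoord_sum_smul_momCurve, lastCoord_sum_smul_momCurve] at hlt
    have hmom := (sum_smul_momCurve_eq_iff (2 * d) A S w v (fun n => (n : ℝ)) (fun n => (n : ℝ))
      (hw1.trans hv1.symm)).1 (hwx.trans hvx.symm)
    set a := A.orderEmbOfFin hAc
    have haA : Finset.image a Finset.univ = A := Finset.image_orderEmbOfFin_univ A hAc
    have hgap : ∀ i, ∃ s ∈ S, s < a i ∧ ∀ j < i, a j < s := by
      intro i
      obtain ⟨P, hP, hdeg, hzero, hneg⟩ := exists_monic_vanishing d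
        (a := fun j => (a j : ℝ)) (Nat.strictMono_cast.comp a.strictMono) i
      obtain ⟨s, hs, hs'⟩ := exists_eval_neg_of_moments (2 * d) A S w v _ _ hv0 hmom hlt hP hdeg
        fun n hn => by
          rw [← haA] at hn
          obtain ⟨j, -, rfl⟩ := Finset.mem_image.1 hn
          exact hzero j
      obtain ⟨h1, h2⟩ := hneg _ (Nat.cast_nonneg s) hs'
      exact ⟨s, hs, by exact_mod_cast h1, fun j hj => by exact_mod_cast h2 j hj⟩
    choose b hbS hba hab using hgap
    have hb : StrictMono b := fun i j hij => (hba i).trans (hab j i hij)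
    refine hB ⟨Finset.image b Finset.univ, ?_, ⟨S, hS, ?_⟩, b, a, hb, a.strictMono, rfl,
      haA.symm, hba, fun i => hab _ _ Fin.castSucc_lt_succ⟩
    · rw [Finset.card_image_of_injective _ hb.injective, Finset.card_univ, Fintype.card_fin]
    · exact Finset.image_subset_iff.2 fun i _ => hbS i
end
end
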